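/- Let f : I ⊆ [0,∞) → ℝ be differentiable on I° with f' integrable on [a,b], where a,b ∈ I° with a < b, and suppose |f'|^q is (1,m)-convex (i.e. m-convex) on [a,b] for some m ∈ (0,1] with mb > a, where q > 1 and 1/p + 1/q = 1. Then |(f(a)+f(mb))/2 − (1/(mb−a)) ∫ₐ^{mb} f(x) dx| ≤ (mb−a)(1/(p+1))^{1/p}(1/4)^{1+1/q}[ (|f'(a)|^q + 3m|f'(b)|^q)^{1/q} + (3|f'(a)|^q + m|f'(b)|^q)^{1/q} ] ≤ (mb−a)(1/4)^{1+1/q}[ (|f'(a)|^q + 3m|f'(b)|^q)^{1/q} + (3|f'(a)|^q + m|f'(b)|^q)^{1/q} ]. -/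

import Mathlib

open MeasureTheory Set Real

/-- A function `g` is `(α,m)`-convex on `s` if
`g (t*x + m*(1-t)*y) ≤ t^α * g x + m*(1-t^α) * g y` for all `x, y ∈ s` and `t ∈ [0,1]`. -/
def AlphaMConvexOn (s : Set ℝ) (α m : ℝ) (g : ℝ → ℝ) : Prop :=
  ∀ x ∈ s, ∀ y ∈ s, ∀ t ∈ Icc (0:ℝ) 1,
    g (t * x + m * (1 - t) * y) ≤ t ^ α * g x + m * (1 - t ^ α) * g y

/-- Hölder's inequality on an interval, for a continuous weight `w` and an integrable `g` whose
`q`-th power is dominated by a continuous function. -/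
theorem integral_abs_mul_abs_le_of_rpow_le {p q u v : ℝ} (hpq : p.HolderConjugate q)
    (huv : u ≤ v) {w g h : ℝ → ℝ} (hw : Continuous w) (hg : IntervalIntegrable g volume u v)
    (hh : Continuous h) (hgh : ∀ x ∈ Icc u v, |g x| ^ q ≤ h x) :
    ∫ x in u..v, |w x| * |g x| ≤
      (∫ x in u..v, |w x| ^ p) ^ (1 / p) * (∫ x in u..v, h x) ^ (1 / q) := by
  have hq0 : 0 < q := hpq.symm.pos
  have hhi : IntervalIntegrable h volume u v := hh.intervalIntegrable u v
  rw [intervalIntegrable_iff_integrableOn_Ioc_of_le huv] at hg hhi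
  have hgae : AEStronglyMeasurable (fun x => |g x|) (volume.restrict (Ioc u v)) :=
    hg.aestronglyMeasurable.norm
  obtain ⟨K, hK⟩ := (isCompact_Icc (a := u) (b := v)).bddAbove_image hh.continuousOn
  have hgL : MemLp (fun x => |g x|) (ENNReal.ofReal q) (volume.restrict (Ioc u v)) := by
    refine MemLp.of_bound hgae (K ^ (1 / q)) ?_
    refine (ae_restrict_iff' measurableSet_Ioc).2 (Filter.Eventually.of_forall fun x hx => ?_)
    have hx' : x ∈ Icc u v := Ioc_subset_Icc_self hx
    have h1 : |g x| ^ q ≤ K := (hgh x hx').trans (hK (mem_image_of_mem h hx'))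
    rw [norm_eq_abs, abs_abs]
    calc |g x| = (|g x| ^ q) ^ (1 / q) := by
          rw [one_div, rpow_rpow_inv (abs_nonneg _) hq0.ne']
      _ ≤ K ^ (1 / q) := by
          exact rpow_le_rpow (by positivity) h1 (by positivity)
  have hwL : MemLp (fun x => |w x|) (ENNReal.ofReal p) (volume.restrict (Ioc u v)) := by
    obtain ⟨M, hM⟩ := (isCompact_Icc (a := u) (b := v)).bddAbove_image hw.abs.continuousOn
    refine MemLp.of_bound hw.abs.aestronglyMeasurable M ?_
    refine (ae_restrict_iff' measurableSet_Ioc).2 (Filter.Eventually.of_forall fun x hx => ?_)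
    rw [norm_eq_abs, abs_abs]
    exact hM (mem_image_of_mem (fun x => |w x|) (Ioc_subset_Icc_self hx))
  have holder := integral_mul_le_Lp_mul_Lq_of_nonneg hpq
    (Filter.Eventually.of_forall fun x => abs_nonneg (w x))
    (Filter.Eventually.of_forall fun x => abs_nonneg (g x)) hwL hgL
  simp only [intervalIntegral.integral_of_le huv]
  refine holder.trans ?_
  have hmono : ∫ x in Ioc u v, |g x| ^ q ≤ ∫ x in Ioc u v, h x :=
    integral_mono_of_nonneg (Filter.Eventually.of_forall fun x => by positivity) hhi
      ((ae_restrict_iff' measurableSet_Ioc).2 (Filter.Eventually.of_forall fun x hx =>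
        hgh x (Ioc_subset_Icc_self hx)))
  have hg0 : 0 ≤ ∫ x in Ioc u v, |g x| ^ q := integral_nonneg fun x => by positivity
  have hw0 : 0 ≤ ∫ x in Ioc u v, |w x| ^ p := integral_nonneg fun x => by positivity
  exact mul_le_mul_of_nonneg_left (rpow_le_rpow hg0 hmono hpq.symm.one_div_nonneg)
    (rpow_nonneg hw0 _)

theorem integral_abs_sub_right_rpow {p u v : ℝ} (hp : 0 < p) (huv : u ≤ v) :
    ∫ x in u..v, |x - v| ^ p = (v - u) ^ (p + 1) / (p + 1) := by
  have h : ∫ x in u..v, |x - v| ^ p = ∫ x in u..v, (v - x) ^ p := by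
    refine intervalIntegral.integral_congr fun x hx => ?_
    rw [uIcc_of_le huv] at hx
    rw [abs_sub_comm, abs_of_nonneg (sub_nonneg.2 hx.2)]
  rw [h, intervalIntegral.integral_comp_sub_left (fun x => x ^ p) v,
    integral_rpow (Or.inl (by linarith))]
  simp [zero_rpow (by linarith : p + 1 ≠ 0)]

theorem integral_abs_sub_left_rpow {p u v : ℝ} (hp : 0 < p) (huv : u ≤ v) :
    ∫ x in u..v, |x - u| ^ p = (v - u) ^ (p + 1) / (p + 1) := by
  have h : ∫ x in u..v, |x - u| ^ p = ∫ x in u..v, (x - u) ^ p := by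
    refine intervalIntegral.integral_congr fun x hx => ?_
    rw [uIcc_of_le huv] at hx
    rw [abs_of_nonneg (sub_nonneg.2 hx.1)]
  rw [h, intervalIntegral.integral_comp_sub_right (fun x => x ^ p) u,
    integral_rpow (Or.inl (by linarith))]
  simp [zero_rpow (by linarith : p + 1 ≠ 0)]

theorem integral_linear_interpolation (a v u w A C : ℝ) :
    ∫ x in u..w, ((v - x) * A + (x - a) * C) / (v - a) =
      ((v * A - a * C) * (w - u) + (C - A) * ((w ^ 2 - u ^ 2) / 2)) / (v - a) := by
  have h : ∀ x : ℝ, ((v - x) * A + (x - a) * C) / (v - a) =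
      ((v * A - a * C) + (C - A) * x) / (v - a) := fun x => by ring
  simp only [h]
  rw [intervalIntegral.integral_div, intervalIntegral.integral_add (by simp)
    ((by fun_prop : Continuous fun x : ℝ => (C - A) * x).intervalIntegrable _ _),
    intervalIntegral.integral_const, intervalIntegral.integral_const_mul, integral_id,
    smul_eq_mul]
  ring

/-- The error of the trapezoid rule as an integral against the derivative. -/
theorem trapezoid_error_eq_integral {f f' : ℝ → ℝ} {a v : ℝ} (hav : a < v)
    (hf : ∀ x ∈ Icc a v, HasDerivAt f (f' x) x) (hint : IntervalIntegrable f' volume a v) :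
    (f a + f v) / 2 - (1 / (v - a)) * ∫ x in a..v, f x =
      (1 / (v - a)) * ∫ x in a..v, (x - (a + v) / 2) * f' x := by
  have h := intervalIntegral.integral_mul_deriv_eq_deriv_mul
    (u := fun x => x - (a + v) / 2) (u' := fun _ => 1) (v := f) (v' := f') (a := a) (b := v)
    (fun x _ => (hasDerivAt_id x).sub_const _)
    (fun x hx => hf x (by rwa [uIcc_of_le hav.le] at hx)) (by simp) hint
  rw [h]
  have : v - a ≠ 0 := (sub_pos.2 hav).ne'
  simp only [one_mul]
  field_simp
  ring

theorem holder_constant_eq {p q L S : ℝ} (hpq : p.HolderConjugate q) (hL : 0 < L) (hS : 0 ≤ S) :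
    1 / L * (((L / 2) ^ (p + 1) / (p + 1)) ^ (1 / p) * (L / 8 * S) ^ (1 / q)) =
      L * (1 / (p + 1)) ^ (1 / p) * (1 / 4 : ℝ) ^ (1 + 1 / q) * S ^ (1 / q) := by
  have hp := hpq.pos
  have hpi : 1 / p = 1 - 1 / q := by
    have := hpq.inv_add_inv_eq_one
    rw [one_div, one_div]; linarith
  have e1 : (p + 1) * (1 / p) = 2 - 1 / q := by
    have : p * (1 / p) = 1 := mul_one_div_cancel hp.ne'
    linarith
  have h8 : (8 : ℝ) = 2 ^ (3 : ℝ) := by norm_num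
  have h4 : (1 / 4 : ℝ) = 2 ^ (-2 : ℝ) := by norm_num [rpow_neg]
  rw [div_eq_mul_one_div ((L / 2) ^ (p + 1)), mul_rpow (by positivity) (by positivity),
    ← rpow_mul (by positivity), e1, mul_rpow (by positivity) hS, h8, h4,
    div_rpow hL.le (by norm_num), div_rpow hL.le (by positivity), ← rpow_mul (by norm_num),
    ← rpow_mul (by norm_num)]
  have hLL : L ^ (2 - 1 / q) * L ^ (1 / q) = L * L := by
    rw [← rpow_add hL]; norm_num [sq]
  have h22 : (2 : ℝ) ^ (-2 * (1 + 1 / q)) * (2 ^ (2 - 1 / q) * 2 ^ (3 * (1 / q))) = 1 := by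
    rw [← rpow_add (by norm_num), ← rpow_add (by norm_num)]
    ring_nf
    simp
  have hx : (0 : ℝ) < 2 ^ (2 - 1 / q) := by positivity
  have hy : (0 : ℝ) < 2 ^ (3 * (1 / q)) := by positivity
  generalize (2 : ℝ) ^ (2 - 1 / q) = X at *
  generalize (2 : ℝ) ^ (3 * (1 / q)) = Y at *
  generalize (2 : ℝ) ^ (-2 * (1 + 1 / q)) = Z at *
  generalize L ^ (2 - 1 / q) = P at *
  generalize L ^ (1 / q) = Q at *
  generalize S ^ (1 / q) = R at *
  generalize (1 / (p + 1)) ^ (1 / p) = T at *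
  have hZ : Z = 1 / (X * Y) := by rw [eq_div_iff (by positivity)]; exact h22
  subst hZ
  field_simp
  linear_combination hLL * T * R

theorem trapezoid_holder_m_convex (I : Set ℝ) (hI : I.OrdConnected) (hI0 : I ⊆ Ici (0:ℝ))
    (f f' : ℝ → ℝ) (a b m p q : ℝ)
    (ha : a ∈ interior I) (hb : b ∈ interior I) (hab : a < b)
    (hm : m ∈ Ioc (0:ℝ) 1) (hmb : a < m * b)
    (hq : 1 < q) (hpq : 1 / p + 1 / q = 1)
    (hdiff : ∀ x ∈ interior I, HasDerivAt f (f' x) x)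
    (hint : IntervalIntegrable f' volume a b)
    (hconv : AlphaMConvexOn (Icc a b) 1 m (fun x => |f' x| ^ q)) :
    |(f a + f (m * b)) / 2 - (1 / (m * b - a)) * ∫ x in a..(m * b), f x|
      ≤ (m * b - a) * (1 / (p + 1)) ^ (1 / p) * (1 / 4 : ℝ) ^ (1 + 1 / q) *
        ((|f' a| ^ q + 3 * m * |f' b| ^ q) ^ (1 / q)
          + (3 * |f' a| ^ q + m * |f' b| ^ q) ^ (1 / q)) ∧
    (m * b - a) * (1 / (p + 1)) ^ (1 / p) * (1 / 4 : ℝ) ^ (1 + 1 / q) *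
        ((|f' a| ^ q + 3 * m * |f' b| ^ q) ^ (1 / q)
          + (3 * |f' a| ^ q + m * |f' b| ^ q) ^ (1 / q))
      ≤ (m * b - a) * (1 / 4 : ℝ) ^ (1 + 1 / q) *
        ((|f' a| ^ q + 3 * m * |f' b| ^ q) ^ (1 / q)
          + (3 * |f' a| ^ q + m * |f' b| ^ q) ^ (1 / q)) := by
  obtain ⟨hm0, hm1⟩ := hm
  have ha0 : 0 ≤ a := hI0 (interior_subset ha)
  have hq0 : 0 < q := by linarith
  have hqp : q.HolderConjugate p := by
    refine (holderConjugate_iff).2 ⟨hq, ?_⟩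
    rw [one_div, one_div] at hpq
    linarith
  have hpq' : p.HolderConjugate q := hqp.symm
  have hp0 : 0 < p := hpq'.pos
  have hmbb : m * b ≤ b := mul_le_of_le_one_left (by linarith) hm1
  set v := m * b with hv
  have hL : 0 < v - a := sub_pos.2 hmb
  have hint' : IntervalIntegrable f' volume a v := hint.mono_set (by
    rw [uIcc_of_le hmb.le, uIcc_of_le hab.le]
    exact Icc_subset_Icc_right hmbb)
  have hder : ∀ x ∈ Icc a v, HasDerivAt f (f' x) x := fun x hx =>
    hdiff x (hI.interior.out ha hb ⟨hx.1, hx.2.trans hmbb⟩)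
  set A := |f' a| ^ q with hA
  set B := |f' b| ^ q with hB
  have hA0 : 0 ≤ A := by positivity
  have hB0 : 0 ≤ B := by positivity
  have hbound : ∀ x ∈ Icc a v, |f' x| ^ q ≤ ((v - x) * A + (x - a) * (m * B)) / (v - a) := by
    intro x hx
    have ht : (v - x) / (v - a) ∈ Icc (0 : ℝ) 1 :=
      ⟨div_nonneg (by linarith [hx.2]) hL.le, (div_le_one hL).2 (by linarith [hx.1])⟩
    have h := hconv a (left_mem_Icc.2 hab.le) b (right_mem_Icc.2 hab.le) _ ht
    have e : (v - x) / (v - a) * a + m * (1 - (v - x) / (v - a)) * b = x := by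
      rw [show m * (1 - (v - x) / (v - a)) * b = (1 - (v - x) / (v - a)) * v by rw [hv]; ring]
      field_simp
      ring
    rw [e, rpow_one] at h
    refine h.trans_eq ?_
    simp only [← hA, ← hB]
    field_simp
    ring
  set c := (a + v) / 2 with hc
  have hac : a ≤ c := by linarith
  have hcv : c ≤ v := by linarith
  have hi1 : IntervalIntegrable f' volume a c := hint'.mono_set (by
    rw [uIcc_of_le hmb.le, uIcc_of_le hac]
    exact Icc_subset_Icc_right hcv)
  have hi2 : IntervalIntegrable f' volume c v := hint'.mono_set (by
    rw [uIcc_of_le hmb.le, uIcc_of_le hcv]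
    exact Icc_subset_Icc_left hac)
  have hw : Continuous fun x : ℝ => x - c := by fun_prop
  have hh : Continuous fun x : ℝ => ((v - x) * A + (x - a) * (m * B)) / (v - a) := by fun_prop
  have H1 := integral_abs_mul_abs_le_of_rpow_le hpq' hac hw hi1 hh
    fun x hx => hbound x ⟨hx.1, hx.2.trans hcv⟩
  have H2 := integral_abs_mul_abs_le_of_rpow_le hpq' hcv hw hi2 hh
    fun x hx => hbound x ⟨hac.trans hx.1, hx.2⟩
  rw [integral_abs_sub_right_rpow hp0 hac, integral_linear_interpolation] at H1
  rw [integral_abs_sub_left_rpow hp0 hcv, integral_linear_interpolation] at H2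
  have s1 : ((v * A - a * (m * B)) * (c - a) + (m * B - A) * ((c ^ 2 - a ^ 2) / 2)) / (v - a)
      = (v - a) / 8 * (3 * A + m * B) := by
    rw [div_eq_iff hL.ne', hc]; ring
  have s2 : ((v * A - a * (m * B)) * (v - c) + (m * B - A) * ((v ^ 2 - c ^ 2) / 2)) / (v - a)
      = (v - a) / 8 * (A + 3 * m * B) := by
    rw [div_eq_iff hL.ne', hc]; ring
  rw [s1, show c - a = (v - a) / 2 by rw [hc]; ring] at H1
  rw [s2, show v - c = (v - a) / 2 by rw [hc]; ring] at H2
  constructor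
  · rw [trapezoid_error_eq_integral hmb hder hint', abs_mul,
      abs_of_pos (one_div_pos.2 hL), mul_add]
    have habs : |∫ x in a..v, (x - c) * f' x| ≤ ∫ x in a..v, |x - c| * |f' x| := by
      simpa only [abs_mul] using
        intervalIntegral.abs_integral_le_integral_abs (f := fun x => (x - c) * f' x) hmb.le
    have hsplit := intervalIntegral.integral_add_adjacent_intervals
      (hi1.abs.continuousOn_mul hw.abs.continuousOn) (hi2.abs.continuousOn_mul hw.abs.continuousOn)
    rw [← holder_constant_eq hpq' hL (by positivity), ← holder_constant_eq hpq' hL (by positivity),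
      ← mul_add]
    refine mul_le_mul_of_nonneg_left ?_ (one_div_pos.2 hL).le
    linarith
  · refine mul_le_mul_of_nonneg_right (mul_le_mul_of_nonneg_right ?_ (by positivity))
      (by positivity)
    refine mul_le_of_le_one_right hL.le (rpow_le_one (by positivity) ?_ (by positivity))
    exact (div_le_one (by linarith)).2 (by linarith)
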